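/- Let P be a standard parabolic submonoid of M satisfying Assumption 1 and let g be a P-ribbon. Then the conjugates by g of the atoms of P are exactly the atoms of P^g, and moreover Δ_P^g = Δ_{P^g}. -/

import Mathlib

/-!
Common setting: Garside monoids, standard parabolic submonoids, heads,
ribbons, following Digne–Michel, "Ribbons in Garside monoids".
-/

namespace GarsidePaper

variable {M : Type*}

/-- `a` left-divides `b` : `b = a * c` for some `c`. -/
def LDvd [Monoid M] (a b : M) : Prop := ∃ c, b = a * c

/-- `a` right-divides `b` : `b = c * a` for some `c`. -/
def RDvd [Monoid M] (a b : M) : Prop := ∃ c, b = c * a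

/-- `a` is a factor of `b` : `a` left-divides a right-divisor of `b`. -/
def IsFactor [Monoid M] (a b : M) : Prop := ∃ c, LDvd a c ∧ RDvd c b

/-- A Garside structure on a (left- and right-) cancellative monoid `M`:
left/right gcds and lcms, Noetherianity, and a Garside element `Δ`. -/
structure GarsideStruct (M : Type*) [CancelMonoid M] where
  /-- left-gcd : gcd for the left-divisibility order -/
  lgcd : M → M → M
  lgcd_dvd_left : ∀ a b, LDvd (lgcd a b) a
  lgcd_dvd_right : ∀ a b, LDvd (lgcd a b) b
  lgcd_greatest : ∀ a b d, LDvd d a → LDvd d b → LDvd d (lgcd a b)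
  /-- right-lcm : lcm for the left-divisibility order -/
  rlcm : M → M → M
  ldvd_rlcm_left : ∀ a b, LDvd a (rlcm a b)
  ldvd_rlcm_right : ∀ a b, LDvd b (rlcm a b)
  rlcm_least : ∀ a b m, LDvd a m → LDvd b m → LDvd (rlcm a b) m
  /-- right-gcd : gcd for the right-divisibility order -/
  rgcd : M → M → M
  rgcd_dvd_left : ∀ a b, RDvd (rgcd a b) a
  rgcd_dvd_right : ∀ a b, RDvd (rgcd a b) b
  rgcd_greatest : ∀ a b d, RDvd d a → RDvd d b → RDvd d (rgcd a b)
  /-- left-lcm : lcm for the right-divisibility order -/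
  llcm : M → M → M
  rdvd_llcm_left : ∀ a b, RDvd a (llcm a b)
  rdvd_llcm_right : ∀ a b, RDvd b (llcm a b)
  llcm_least : ∀ a b m, RDvd a m → RDvd b m → RDvd (llcm a b) m
  /-- Noetherian: no infinite sequence where each term is a proper factor
  of the previous one. -/
  noetherian : WellFounded (fun a b : M => IsFactor a b ∧ a ≠ b)
  /-- the Garside element -/
  Δ : M
  /-- the left- and right-divisors of `Δ` coincide -/
  delta_balanced : ∀ a : M, LDvd a Δ ↔ RDvd a Δ
  /-- the divisors of `Δ` generate `M` -/
  delta_generates : Submonoid.closure {a : M | LDvd a Δ} = ⊤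

variable [CancelMonoid M]

/-- An atom: an element with no proper nontrivial divisor (factor). -/
def IsAtom' (a : M) : Prop := a ≠ 1 ∧ ∀ b : M, IsFactor b a → b = 1 ∨ b = a

/-- A standard parabolic submonoid: a submonoid closed under factors in which
every element of `M` has a maximal left-divisor (the left `P`-head) and a
maximal right-divisor (the right `P`-head) lying in `P`. -/
structure IsStdParabolic (P : Submonoid M) : Prop where
  factor_closed : ∀ a b : M, b ∈ P → IsFactor a b → a ∈ P
  exists_left_head : ∀ g : M, ∃ h, h ∈ P ∧ LDvd h g ∧
    ∀ h', h' ∈ P → LDvd h' g → LDvd h' h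
  exists_right_head : ∀ g : M, ∃ h, h ∈ P ∧ RDvd h g ∧
    ∀ h', h' ∈ P → RDvd h' g → RDvd h' h

/-- `h` is the left `P`-head `H_P g` of `g` : the maximal left-divisor of `g`
lying in `P`. -/
def IsLeftHead (P : Set M) (g h : M) : Prop :=
  h ∈ P ∧ LDvd h g ∧ ∀ h', h' ∈ P → LDvd h' g → LDvd h' h

/-- `h` is the right `P`-head of `g` : the maximal right-divisor of `g`
lying in `P`. -/
def IsRightHead (P : Set M) (g h : M) : Prop :=
  h ∈ P ∧ RDvd h g ∧ ∀ h', h' ∈ P → RDvd h' g → RDvd h' h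

/-- `g` is `P`-reduced : `H_P g = 1`, i.e. the only left-divisor of `g`
lying in `P` is `1`. -/
def PReduced (P : Set M) (g : M) : Prop := ∀ h ∈ P, LDvd h g → h = 1

/-- `P ^ g` is defined: `p ^ g` is defined (`g ≼ p * g`) for every `p ∈ P`. -/
def ConjSetDef (P : Set M) (g : M) : Prop := ∀ p ∈ P, LDvd g (p * g)

/-- The set `P ^ g = { p ^ g : p ∈ P }`, where `p ^ g` is the unique `c`
with `p * g = g * c`. -/
def conjSet (P : Set M) (g : M) : Set M := {c : M | ∃ p ∈ P, p * g = g * c}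

/-- A `P`-ribbon: a `P`-reduced element `g` such that `P ^ g` is defined. -/
def IsRibbon (P : Set M) (g : M) : Prop := PReduced P g ∧ ConjSetDef P g

/-- `P` is the smallest standard parabolic submonoid containing `S₁`. -/
def IsSmallestParabolicContaining (S₁ : Set M) (P : Submonoid M) : Prop :=
  IsStdParabolic P ∧ S₁ ⊆ (P : Set M) ∧
    ∀ Q : Submonoid M, IsStdParabolic Q → S₁ ⊆ (Q : Set M) → P ≤ Q

/-- Assumption 1: for any set `S₁` of atoms, the right-lcm of `S₁` is the
Garside element `Δ_{P₁} = H_{P₁}(Δ)` of the smallest standard parabolic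
submonoid `P₁` containing `S₁`. -/
def Assumption1 (G : GarsideStruct M) : Prop :=
  ∀ S₁ : Set M, (∀ s ∈ S₁, IsAtom' s) →
    ∀ P₁ : Submonoid M, IsSmallestParabolicContaining S₁ P₁ →
      ∀ d : M, IsLeftHead (P₁ : Set M) G.Δ d →
        (∀ s ∈ S₁, LDvd s d) ∧ ∀ m : M, (∀ s ∈ S₁, LDvd s m) → LDvd d m

/-- Assumption 2: some (positive) power of `Δ` is central. -/
def Assumption2 (G : GarsideStruct M) : Prop :=
  ∃ n : ℕ, 0 < n ∧ ∀ x : M, G.Δ ^ n * x = x * G.Δ ^ n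

/-- `v = v_{s,P}` : the element defined by `Δ_{P_s} = Δ_P * v`, where `P_s`
is the smallest standard parabolic submonoid containing `P` and `s`. -/
def IsVsp (G : GarsideStruct M) (P : Submonoid M) (s v : M) : Prop :=
  ∃ Ps : Submonoid M, IsSmallestParabolicContaining ((P : Set M) ∪ {s}) Ps ∧
    ∃ dP dPs : M, IsLeftHead (P : Set M) G.Δ dP ∧
      IsLeftHead (Ps : Set M) G.Δ dPs ∧ dPs = dP * v

theorem LDvd.trans {a b c : M} (h₁ : LDvd a b) (h₂ : LDvd b c) : LDvd a c := by
  obtain ⟨x, rfl⟩ := h₁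
  obtain ⟨y, rfl⟩ := h₂
  exact ⟨x * y, mul_assoc _ _ _⟩

theorem RDvd.trans {a b c : M} (h₁ : RDvd a b) (h₂ : RDvd b c) : RDvd a c := by
  obtain ⟨x, rfl⟩ := h₁
  obtain ⟨y, rfl⟩ := h₂
  exact ⟨y * x, (mul_assoc _ _ _).symm⟩

theorem LDvd.of_mul_left {a b c : M} (h : LDvd (a * b) (a * c)) : LDvd b c := by
  obtain ⟨x, hx⟩ := h
  exact ⟨x, mul_left_cancel (hx.trans (mul_assoc _ _ _))⟩

theorem LDvd.mul_left {b c : M} (h : LDvd b c) (a : M) : LDvd (a * b) (a * c) := by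
  obtain ⟨x, rfl⟩ := h
  exact ⟨x, (mul_assoc _ _ _).symm⟩

theorem LDvd.isFactor {a b : M} (h : LDvd a b) : IsFactor a b :=
  ⟨b, h, ⟨1, (one_mul b).symm⟩⟩

theorem RDvd.isFactor {a b : M} (h : RDvd a b) : IsFactor a b :=
  ⟨a, ⟨1, (mul_one a).symm⟩, h⟩

theorem IsFactor.antisymm (G : GarsideStruct M) {a b : M} (hab : IsFactor a b)
    (hba : IsFactor b a) : a = b := by
  by_contra hne
  exact G.noetherian.asymmetric a b ⟨hab, hne⟩ ⟨hba, Ne.symm hne⟩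

theorem eq_one_of_mul_eq_one (G : GarsideStruct M) {a b : M} (h : a * b = 1) : a = 1 :=
  IsFactor.antisymm G (LDvd.isFactor ⟨b, h.symm⟩) (LDvd.isFactor ⟨a, (one_mul a).symm⟩)

theorem isAtom'_of_mul_eq (G : GarsideStruct M) {a : M} (ha : a ≠ 1)
    (h : ∀ x y, a = x * y → x = 1 ∨ y = 1) : IsAtom' a := by
  refine ⟨ha, ?_⟩
  rintro b ⟨_, ⟨y, rfl⟩, ⟨x, hx⟩⟩
  rcases h _ _ hx with rfl | hby
  · rw [one_mul] at hx
    rcases h _ _ hx with hb | rfl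
    · exact Or.inl hb
    · exact Or.inr (hx.trans (mul_one b)).symm
  · exact Or.inl (eq_one_of_mul_eq_one G hby)

theorem IsAtom'.eq_one_or_eq_one {a x y : M} (ha : IsAtom' a) (h : a = x * y) :
    x = 1 ∨ y = 1 := by
  rcases ha.2 x (LDvd.isFactor ⟨y, h⟩) with hx | rfl
  · exact Or.inl hx
  · exact Or.inr (left_eq_mul.mp h)

theorem exists_atom_ldvd (G : GarsideStruct M) (x : M) (hx : x ≠ 1) :
    ∃ a, IsAtom' a ∧ LDvd a x := by
  induction x using G.noetherian.induction with
  | _ x ih =>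
    by_cases h : ∀ u v, x = u * v → u = 1 ∨ v = 1
    · exact ⟨x, isAtom'_of_mul_eq G hx h, 1, (mul_one x).symm⟩
    · push Not at h
      obtain ⟨u, v, huv, hu, hv⟩ := h
      have hdvd : LDvd u x := ⟨v, huv⟩
      obtain ⟨a, ha, hau⟩ := ih u ⟨hdvd.isFactor, fun h => hv (by simpa [h] using huv)⟩ hu
      exact ⟨a, ha, hau.trans hdvd⟩

theorem IsStdParabolic.le_of_atoms (G : GarsideStruct M) {P Q : Submonoid M}
    (hP : IsStdParabolic P) (h : ∀ a ∈ P, IsAtom' a → a ∈ Q) : P ≤ Q := by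
  intro p hp
  induction p using G.noetherian.induction with
  | _ p ih =>
    by_cases hp1 : p = 1
    · exact hp1 ▸ Q.one_mem
    obtain ⟨a, ha, q, rfl⟩ := exists_atom_ldvd G p hp1
    have hfac : IsFactor q (a * q) := RDvd.isFactor ⟨a, rfl⟩
    refine Q.mul_mem (h a (hP.factor_closed _ _ hp (LDvd.isFactor ⟨q, rfl⟩)) ha)
      (ih q ⟨hfac, fun h => ha.1 (right_eq_mul.mp h)⟩ (hP.factor_closed _ _ hp hfac))

theorem IsStdParabolic.rlcm_mem (G : GarsideStruct M) {P : Submonoid M}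
    (hP : IsStdParabolic P) {a b x : M} (ha : a ∈ P) (hb : b ∈ P) (hax : LDvd a x)
    (hbx : LDvd b x) : G.rlcm a b ∈ P := by
  obtain ⟨h, hh, -, hmax⟩ := hP.exists_left_head x
  exact hP.factor_closed _ _ hh (G.rlcm_least _ _ _ (hmax a ha hax) (hmax b hb hbx)).isFactor

theorem IsStdParabolic.llcm_mem (G : GarsideStruct M) {P : Submonoid M}
    (hP : IsStdParabolic P) {a b x : M} (ha : a ∈ P) (hb : b ∈ P) (hax : RDvd a x)
    (hbx : RDvd b x) : G.llcm a b ∈ P := by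
  obtain ⟨h, hh, -, hmax⟩ := hP.exists_right_head x
  exact hP.factor_closed _ _ hh (G.llcm_least _ _ _ (hmax a ha hax) (hmax b hb hbx)).isFactor

/-- An intersection of standard parabolic submonoids is standard parabolic. -/
theorem isStdParabolic_sInf (G : GarsideStruct M) (C : Set (Submonoid M))
    (hC : ∀ Q ∈ C, IsStdParabolic Q) : IsStdParabolic (sInf C) := by
  refine ⟨?_, ?_, ?_⟩
  · intro a b hb hab
    rw [Submonoid.mem_sInf] at hb ⊢
    exact fun Q hQ => (hC Q hQ).factor_closed a b (hb Q hQ) hab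
  · intro x
    obtain ⟨y, ⟨h, hh, hx⟩, hmin⟩ := G.noetherian.has_min
      {y | ∃ h ∈ sInf C, x = h * y} ⟨x, 1, one_mem _, (one_mul x).symm⟩
    refine ⟨h, hh, ⟨y, hx⟩, fun h' hh' hdvd => ?_⟩
    have hm : G.rlcm h h' ∈ sInf C := by
      rw [Submonoid.mem_sInf] at hh hh' ⊢
      exact fun Q hQ => (hC Q hQ).rlcm_mem G (hh Q hQ) (hh' Q hQ) ⟨y, hx⟩ hdvd
    obtain ⟨z, hz⟩ := G.rlcm_least h h' x ⟨y, hx⟩ hdvd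
    obtain ⟨n, hn⟩ := G.ldvd_rlcm_left h h'
    have hy : y = n * z := by
      rw [hx, hn, mul_assoc] at hz
      exact mul_left_cancel hz
    have hzy : z = y := by
      by_contra hne
      exact hmin z ⟨_, hm, hz⟩ ⟨RDvd.isFactor ⟨n, hy⟩, hne⟩
    have hn1 : n = 1 := by
      rw [hzy] at hy
      exact right_eq_mul.mp hy
    have := G.ldvd_rlcm_right h h'
    rwa [hn, hn1, mul_one] at this
  · intro x
    obtain ⟨y, ⟨h, hh, hx⟩, hmin⟩ := G.noetherian.has_min
      {y | ∃ h ∈ sInf C, x = y * h} ⟨x, 1, one_mem _, (mul_one x).symm⟩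
    refine ⟨h, hh, ⟨y, hx⟩, fun h' hh' hdvd => ?_⟩
    have hm : G.llcm h h' ∈ sInf C := by
      rw [Submonoid.mem_sInf] at hh hh' ⊢
      exact fun Q hQ => (hC Q hQ).llcm_mem G (hh Q hQ) (hh' Q hQ) ⟨y, hx⟩ hdvd
    obtain ⟨z, hz⟩ := G.llcm_least h h' x ⟨y, hx⟩ hdvd
    obtain ⟨n, hn⟩ := G.rdvd_llcm_left h h'
    have hy : y = z * n := by
      rw [hx, hn, ← mul_assoc] at hz
      exact mul_right_cancel hz
    have hzy : z = y := by
      by_contra hne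
      exact hmin z ⟨_, hm, hz⟩ ⟨LDvd.isFactor ⟨n, hy⟩, hne⟩
    have hn1 : n = 1 := by
      rw [hzy] at hy
      exact left_eq_mul.mp hy
    have := G.rdvd_llcm_right h h'
    rwa [hn, hn1, one_mul] at this

theorem exists_isSmallestParabolicContaining (G : GarsideStruct M) (S : Set M) :
    ∃ Q : Submonoid M, IsSmallestParabolicContaining S Q := by
  refine ⟨sInf {Q | IsStdParabolic Q ∧ S ⊆ (Q : Set M)},
    isStdParabolic_sInf G _ fun Q hQ => hQ.1, fun s hs => ?_, fun Q hQ hS => sInf_le ⟨hQ, hS⟩⟩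
  exact Submonoid.mem_sInf.mpr fun Q hQ => hQ.2 hs

/-- The left- and right-divisors of the Garside element of a standard parabolic submonoid
coincide. -/
theorem IsLeftHead.ldvd_iff_rdvd (G : GarsideStruct M) {Q : Submonoid M}
    (hQ : IsStdParabolic Q) {d : M} (hd : IsLeftHead (Q : Set M) G.Δ d) (x : M) :
    LDvd x d ↔ RDvd x d := by
  obtain ⟨hdQ, hdΔ, hmax⟩ := hd
  constructor
  · intro hx
    obtain ⟨d', hd'Q, hd'Δ, hmax'⟩ := hQ.exists_right_head G.Δ
    have h₁ : LDvd d' d := hmax d' hd'Q ((G.delta_balanced _).mpr hd'Δ)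
    have h₂ : RDvd d d' := hmax' d hdQ ((G.delta_balanced _).mp hdΔ)
    rw [h₂.isFactor.antisymm G h₁.isFactor] at hdQ hdΔ hx ⊢
    exact hmax' x (hQ.factor_closed _ _ hdQ hx.isFactor)
      ((G.delta_balanced _).mp (hx.trans hdΔ))
  · intro hx
    exact hmax x (hQ.factor_closed _ _ hdQ hx.isFactor)
      ((G.delta_balanced _).mpr (hx.trans ((G.delta_balanced _).mp hdΔ)))

theorem isAtom'_of_balanced (G : GarsideStruct M) {d a δ a' : M}
    (hd : ∀ x, LDvd x d ↔ RDvd x d) (ha : IsAtom' a) (h : d = a * δ) (h' : d = δ * a') :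
    IsAtom' a' := by
  refine isAtom'_of_mul_eq G ?_ ?_
  · rintro rfl
    exact ha.1 (right_eq_mul.mp ((mul_one δ).symm.trans (h'.symm.trans h)))
  · rintro x y rfl
    obtain ⟨z, hz⟩ := (hd (δ * x)).mp ⟨y, by rw [h', mul_assoc]⟩
    obtain ⟨u, hu⟩ := (hd (z * δ)).mp ⟨x, by rw [hz, mul_assoc]⟩
    have hauz : a = u * z := mul_right_cancel (b := δ) (by rw [← h, hu, mul_assoc])
    rcases ha.eq_one_or_eq_one hauz with rfl | rfl
    · left
      rw [one_mul] at hauz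
      rw [h, hauz, ← mul_assoc] at hz
      exact left_eq_mul.mp hz
    · right
      rw [one_mul, h', ← mul_assoc] at hz
      exact mul_eq_left.mp hz

theorem Assumption1.isAtom'_conj {G : GarsideStruct M} (hA : Assumption1 G) {g : M} :
    ∀ {a c : M}, IsAtom' a → ¬ LDvd a g → a * g = g * c → IsAtom' c := by
  induction g using G.noetherian.induction with
  | _ g ih =>
    intro a c ha hag hc
    by_cases hg : g = 1
    · subst hg
      rw [mul_one, one_mul] at hc
      exact hc ▸ ha
    obtain ⟨b, hb, hbg⟩ := exists_atom_ldvd G g hg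
    obtain ⟨Q, hQ⟩ := exists_isSmallestParabolicContaining G {a, b}
    obtain ⟨d, hd⟩ := hQ.1.exists_left_head G.Δ
    obtain ⟨hub, hlub⟩ := hA {a, b} (by rintro s (rfl | rfl) <;> assumption) Q hQ d hd
    have hbal := IsLeftHead.ldvd_iff_rdvd G hQ.1 hd
    obtain ⟨δ, hδ⟩ := hub a (by simp)
    obtain ⟨a', ha'⟩ := (hbal δ).mpr ⟨a, hδ⟩
    have hdag : LDvd d (a * g) := by
      refine hlub _ ?_
      rintro s (rfl | rfl)
      · exact ⟨g, rfl⟩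
      · exact hbg.trans ⟨c, hc⟩
    obtain ⟨k, rfl⟩ : LDvd δ g := by
      rw [hδ] at hdag
      exact hdag.of_mul_left
    refine ih k ⟨RDvd.isFactor ⟨δ, rfl⟩, fun hk => ?_⟩
      (isAtom'_of_balanced G hbal ha hδ ha') ?_ ?_
    · have hδ1 : δ = 1 := right_eq_mul.mp hk
      have hba : LDvd b a := by
        have := hub b (by simp)
        rwa [hδ, hδ1, mul_one] at this
      rcases ha.2 b hba.isFactor with h | h
      · exact hb.1 h
      · exact hag (h ▸ hbg)
    · rintro ⟨l, rfl⟩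
      refine hag ⟨δ * l, ?_⟩
      rw [← mul_assoc, ← mul_assoc, ← ha', hδ]
    · refine mul_left_cancel (a := δ) ?_
      rw [← mul_assoc, ← mul_assoc, ← hc, ← mul_assoc, ← ha', hδ]

theorem IsRibbon.isAtom'_conj {G : GarsideStruct M} (hA : Assumption1 G) {P : Set M} {g : M}
    (hg : IsRibbon P g) {a c : M} (haP : a ∈ P) (ha : IsAtom' a) (hc : a * g = g * c) :
    IsAtom' c :=
  hA.isAtom'_conj ha (fun h => ha.1 (hg.1 a haP h)) hc

/-- If `g` is a `P`-ribbon, then `p * g` is the right-lcm of `p` and `g` for all `p ∈ P`. -/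
theorem IsRibbon.mul_ldvd {G : GarsideStruct M} (hA : Assumption1 G) {P : Submonoid M}
    (hP : IsStdParabolic P) {g : M} (hg : IsRibbon (P : Set M) g) {p : M} (hp : p ∈ P) :
    ∀ {m : M}, LDvd p m → LDvd g m → LDvd (p * g) m := by
  induction p using G.noetherian.induction with
  | _ p ih =>
    intro m hpm hgm
    by_cases hp1 : p = 1
    · rwa [hp1, one_mul]
    obtain ⟨a, ha, q, rfl⟩ := exists_atom_ldvd G p hp1
    have haP : a ∈ P := hP.factor_closed _ _ hp (LDvd.isFactor ⟨q, rfl⟩)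
    have hq : IsFactor q (a * q) := RDvd.isFactor ⟨a, rfl⟩
    have hagm : LDvd (a * g) m := by
      obtain ⟨c, hc⟩ := hg.2 a haP
      have hlcm := G.rlcm_least a g m (LDvd.trans ⟨q, rfl⟩ hpm) hgm
      obtain ⟨y, hy⟩ := G.rlcm_least a g (a * g) ⟨g, rfl⟩ ⟨c, hc⟩
      obtain ⟨x, hx⟩ := G.ldvd_rlcm_right a g
      have hcxy : c = x * y :=
        mul_left_cancel (a := g) (by rw [← hc, hy, hx, mul_assoc])
      rcases (hg.isAtom'_conj hA haP ha hc).eq_one_or_eq_one hcxy with rfl | rfl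
      · rw [mul_one] at hx
        exact absurd (hg.1 a haP (hx ▸ G.ldvd_rlcm_left a g)) ha.1
      · rwa [hy, mul_one]
    obtain ⟨m', rfl⟩ : LDvd a m := LDvd.trans ⟨g, rfl⟩ hagm
    rw [mul_assoc]
    exact (ih q ⟨hq, fun h => ha.1 (right_eq_mul.mp h)⟩ (hP.factor_closed _ _ hp hq)
      hpm.of_mul_left hagm.of_mul_left).mul_left a

/-- The submonoid of elements whose conjugate by `g` is defined and lies in `Q`. -/
def conjComap (Q : Submonoid M) (g : M) : Submonoid M where
  carrier := {p | ∃ c ∈ Q, p * g = g * c}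
  one_mem' := ⟨1, Q.one_mem, by rw [one_mul, mul_one]⟩
  mul_mem' := by
    rintro p q ⟨c, hc, hpc⟩ ⟨e, he, hqe⟩
    exact ⟨c * e, Q.mul_mem hc he, by rw [mul_assoc, hqe, ← mul_assoc, hpc, mul_assoc]⟩

/-- if `g` is a `P`-ribbon, the conjugates by `g` of the atoms
of `P` are exactly the atoms of `P ^ g`, and `Δ_P ^ g = Δ_{P ^ g}` (the
conjugate of `Δ_P` is the left head of `Δ` in `P ^ g`). -/
theorem statement5 (G : GarsideStruct M) (hA : Assumption1 G)
    (P : Submonoid M) (hP : IsStdParabolic P)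
    (g : M) (hg : IsRibbon (P : Set M) g) :
    ({c : M | ∃ a ∈ P, IsAtom' a ∧ a * g = g * c}
      = {c ∈ conjSet (P : Set M) g | IsAtom' c}) ∧
    (∀ dP c : M, IsLeftHead (P : Set M) G.Δ dP → dP * g = g * c →
      IsLeftHead (conjSet (P : Set M) g) G.Δ c) := by
  refine ⟨Set.ext fun c => ⟨?_, ?_⟩, ?_⟩
  · rintro ⟨a, haP, ha, hc⟩
    exact ⟨⟨a, haP, hc⟩, hg.isAtom'_conj hA haP ha hc⟩
  · rintro ⟨⟨p, hp, hpc⟩, hc⟩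
    have hp1 : p ≠ 1 := by
      rintro rfl
      rw [one_mul] at hpc
      exact hc.1 (left_eq_mul.mp hpc)
    obtain ⟨a, ha, q, rfl⟩ := exists_atom_ldvd G p hp1
    have haP : a ∈ P := hP.factor_closed _ _ hp (LDvd.isFactor ⟨q, rfl⟩)
    have hqP : q ∈ P := hP.factor_closed _ _ hp (RDvd.isFactor ⟨a, rfl⟩)
    obtain ⟨e, he⟩ := hg.2 a haP
    obtain ⟨f, hf⟩ := hg.2 q hqP
    have hcef : c = e * f := mul_left_cancel (a := g) (by
      rw [← hpc, mul_assoc, hf, ← mul_assoc, he, mul_assoc])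
    rcases hc.eq_one_or_eq_one hcef with rfl | rfl
    · exact absurd rfl (hg.isAtom'_conj hA haP ha he).1
    · rw [mul_one] at hcef
      exact ⟨a, haP, ha, hcef ▸ he⟩
  · intro d c hd hdc
    have hsmall : IsSmallestParabolicContaining {a | a ∈ P ∧ IsAtom' a} P :=
      ⟨hP, fun a ha => ha.1, fun Q _ hQ => hP.le_of_atoms G fun a haP ha => hQ ⟨haP, ha⟩⟩
    obtain ⟨hub, hlub⟩ := hA _ (fun a ha => ha.2) P hsmall d hd
    set S : Set M := {c | ∃ a ∈ P, IsAtom' a ∧ a * g = g * c}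
    obtain ⟨Q, hQ⟩ := exists_isSmallestParabolicContaining G S
    obtain ⟨e, he⟩ := hQ.1.exists_left_head G.Δ
    obtain ⟨hub', hlub'⟩ := hA S
      (fun s ⟨a, haP, ha, has⟩ => hg.isAtom'_conj hA haP ha has) Q hQ e he
    have hec : LDvd e c := by
      refine hlub' c ?_
      rintro s ⟨a, haP, ha, has⟩
      obtain ⟨q, rfl⟩ := hub a ⟨haP, ha⟩
      obtain ⟨f, hf⟩ := hg.2 q (hP.factor_closed _ _ hd.1 (RDvd.isFactor ⟨a, rfl⟩))
      exact ⟨f, mul_left_cancel (a := g) (by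
        rw [← hdc, mul_assoc, hf, ← mul_assoc, has, mul_assoc])⟩
    have hce : LDvd c e := by
      refine LDvd.of_mul_left (a := g) ?_
      rw [← hdc]
      refine hg.mul_ldvd hA hP hd.1 (hlub _ ?_) ⟨e, rfl⟩
      rintro a ⟨haP, ha⟩
      obtain ⟨s, hs⟩ := hg.2 a haP
      refine LDvd.trans ⟨g, rfl⟩ (hs ▸ (hub' s ⟨a, haP, ha, hs⟩).mul_left g)
    refine ⟨⟨d, hd.1, hdc⟩, hce.trans he.2.1, ?_⟩
    rintro h ⟨p, hp, hph⟩ hΔ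
    have hle : P ≤ conjComap Q g := hP.le_of_atoms G fun a haP ha => by
      obtain ⟨s, hs⟩ := hg.2 a haP
      exact ⟨s, hQ.2.1 ⟨a, haP, ha, hs⟩, hs⟩
    obtain ⟨h', hh', hph'⟩ := hle hp
    obtain rfl : h = h' := mul_left_cancel (hph.symm.trans hph')
    exact (he.2.2 h hh' hΔ).trans hec

end GarsidePaper
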